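/- arXiv:2307.06848 — 4 statements merged into one kernel-verified Lean document; each statement's English description precedes it below -/
import Mathlib

section
/- Let X ∈ ℂ^{n1×n2×n3}. Then (F_{n3} ⊗ I_{n1}) · bcirc(X) · ((1/n3)F_{n3}^* ⊗ I_{n2}) is block diagonal, with k-th diagonal block (k = 1,…,n3) equal to the Fourier-transformed frontal slice X̂^{(k)}; here F_{n3} is the DFT matrix, (1/n3)F_{n3}^* = F_{n3}^{−1}, and ⊗ is the Kronecker product. -/
open Matrix Kronecker

/-- The block circulant matrix of a third-order tensor (given by its frontal slices),
indexed so that the `(p,q)` block (0-based) is the frontal slice `X^(p-q mod n3)`. -/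
def bcirc {n1 n2 n3 : ℕ} (X : Fin n3 → Matrix (Fin n1) (Fin n2) ℂ) :
    Matrix (Fin n3 × Fin n1) (Fin n3 × Fin n2) ℂ :=
  Matrix.of fun p q => X (p.1 - q.1) p.2 q.2

/-- The `k`-th Fourier-transformed frontal slice `X̂^(k) = Σ_j ω^(k*j) X^(j)`
(0-based indexing), where `ω = exp(-2πi/n3)`. -/
noncomputable def fourierSlice {n1 n2 n3 : ℕ} (X : Fin n3 → Matrix (Fin n1) (Fin n2) ℂ)
    (k : Fin n3) : Matrix (Fin n1) (Fin n2) ℂ :=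
  ∑ j : Fin n3, (Complex.exp (-2 * Real.pi * Complex.I / n3) ^ ((k : ℕ) * (j : ℕ))) • X j

/-- The DFT kernel turns addition in `Fin n` into multiplication. -/
lemma pow_mul_val_add {M : Type*} [Monoid M] {n : ℕ} [NeZero n] {w : M} (hw : w ^ n = 1)
    (k : ℕ) (i j : Fin n) :
    w ^ (k * ((i + j : Fin n) : ℕ)) = w ^ (k * (i : ℕ)) * w ^ (k * (j : ℕ)) := by
  have hk : (w ^ k) ^ n = 1 := by rw [← pow_mul, mul_comm, pow_mul, hw, one_pow]
  rw [pow_mul, pow_mul, pow_mul, ← pow_add, Fin.val_add, ← pow_eq_pow_mod _ hk]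

/-- Orthogonality of the rows of the DFT matrix of a primitive root of unity. -/
lemma IsPrimitiveRoot.sum_pow_mul_inv_pow {K : Type*} [Field K] {n : ℕ} {w : K}
    (hw : IsPrimitiveRoot w n) (k l : Fin n) :
    ∑ j : Fin n, w ^ ((k : ℕ) * (j : ℕ)) * w⁻¹ ^ ((l : ℕ) * (j : ℕ)) =
      if k = l then (n : K) else 0 := by
  have hw0 : w ≠ 0 := hw.ne_zero (Fin.pos k).ne'
  have hterm (j : Fin n) : w ^ ((k : ℕ) * (j : ℕ)) * w⁻¹ ^ ((l : ℕ) * (j : ℕ)) =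
      (w ^ (k : ℕ) * w⁻¹ ^ (l : ℕ)) ^ (j : ℕ) := by
    rw [mul_pow, pow_mul, pow_mul]
  simp only [hterm]
  split_ifs with h
  · subst h
    simp [hw0]
  · rw [Fin.sum_univ_eq_sum_range (fun j => (w ^ (k : ℕ) * w⁻¹ ^ (l : ℕ)) ^ j) n]
    have hne : w ^ (k : ℕ) * w⁻¹ ^ (l : ℕ) ≠ 1 := by
      intro h1
      rw [inv_pow, mul_inv_eq_one₀ (pow_ne_zero _ hw0)] at h1
      exact h (Fin.ext (hw.pow_inj k.isLt l.isLt h1))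
    have hpow : (w ^ (k : ℕ) * w⁻¹ ^ (l : ℕ)) ^ n = 1 := by
      rw [mul_pow, pow_right_comm, pow_right_comm w⁻¹, inv_pow, hw.pow_eq_one]
      simp
    rw [geom_sum_eq hne, hpow, sub_self, zero_div]

/-- The primitive root of unity used by the DFT. -/
lemma isPrimitiveRoot_exp_neg {n : ℕ} (hn : n ≠ 0) :
    IsPrimitiveRoot (Complex.exp (-2 * Real.pi * Complex.I / n)) n := by
  have h := (Complex.isPrimitiveRoot_exp n hn).inv
  rw [← Complex.exp_neg] at h
  rwa [← neg_div, ← neg_mul, ← neg_mul] at h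

/-- The conjugate of the DFT root of unity is its inverse. -/
lemma star_exp_neg (n : ℕ) :
    star (Complex.exp (-2 * Real.pi * Complex.I / n)) =
      (Complex.exp (-2 * Real.pi * Complex.I / n))⁻¹ := by
  rw [← Complex.exp_neg, Complex.star_def, ← Complex.exp_conj]
  congr 1
  simp [neg_div, Complex.conj_ofNat]

/-- **DFT block-diagonalizes the block circulant matrix**:
`(F_{n3} ⊗ I_{n1}) · bcirc(X) · ((1/n3) F_{n3}ᴴ ⊗ I_{n2})` is block diagonal with `k`-th
diagonal block the Fourier-transformed frontal slice `X̂^(k)`. -/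
theorem bcirc_block_diagonalization (n1 n2 n3 : ℕ) (hn3 : 1 ≤ n3)
    (X : Fin n3 → Matrix (Fin n1) (Fin n2) ℂ)
    (F : Matrix (Fin n3) (Fin n3) ℂ)
    (hF : ∀ j k : Fin n3,
      F j k = Complex.exp (-2 * Real.pi * Complex.I / n3) ^ ((j : ℕ) * (k : ℕ))) :
    (F ⊗ₖ (1 : Matrix (Fin n1) (Fin n1) ℂ)) * bcirc X *
        (((n3 : ℂ)⁻¹ • Fᴴ) ⊗ₖ (1 : Matrix (Fin n2) (Fin n2) ℂ)) =
      Matrix.of (fun (p : Fin n3 × Fin n1) (q : Fin n3 × Fin n2) =>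
        if p.1 = q.1 then fourierSlice X p.1 p.2 q.2 else 0) := by
  have : NeZero n3 := ⟨by omega⟩
  have hw := isPrimitiveRoot_exp_neg (NeZero.ne n3)
  have hstar := star_exp_neg n3
  simp only [fourierSlice]
  set w := Complex.exp (-2 * Real.pi * Complex.I / n3)
  have hleft (k q : Fin n3) (a : Fin n1) (b : Fin n2) :
      ((F ⊗ₖ (1 : Matrix (Fin n1) (Fin n1) ℂ)) * bcirc X) (k, a) (q, b) =
        (∑ j : Fin n3, w ^ ((k : ℕ) * (j : ℕ)) * X j a b) * w ^ ((k : ℕ) * (q : ℕ)) := by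
    simp only [mul_apply, Fintype.sum_prod_type, kroneckerMap_apply, one_apply, bcirc, of_apply,
      mul_ite, mul_one, mul_zero, ite_mul, zero_mul, Finset.sum_ite_eq, Finset.mem_univ, if_true]
    rw [← Equiv.sum_comp (Equiv.addRight q), Finset.sum_mul]
    refine Finset.sum_congr rfl fun j _ => ?_
    rw [Equiv.coe_addRight, hF, pow_mul_val_add hw.pow_eq_one, add_sub_cancel_right]
    ring
  ext ⟨k, a⟩ ⟨l, b⟩
  rw [mul_apply, Fintype.sum_prod_type]
  simp only [hleft, kroneckerMap_apply, Matrix.smul_apply, conjTranspose_apply, hF, star_pow, hstar,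
    one_apply, of_apply, Matrix.sum_apply, smul_eq_mul, mul_ite, mul_one, mul_zero,
    Finset.sum_ite_eq', Finset.mem_univ, if_true]
  have hrow := hw.sum_pow_mul_inv_pow k l
  calc _ = (∑ j : Fin n3, w ^ ((k : ℕ) * (j : ℕ)) * X j a b) * ((n3 : ℂ)⁻¹ *
        ∑ q : Fin n3, w ^ ((k : ℕ) * (q : ℕ)) * w⁻¹ ^ ((l : ℕ) * (q : ℕ))) := by
        rw [Finset.mul_sum, Finset.mul_sum]
        exact Finset.sum_congr rfl fun q _ => by ring
    _ = _ := by
        rw [hrow]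
        split_ifs <;> simp [NeZero.ne n3]
end

section
/- Orthogonal tensors preserve the Frobenius norm under the t-product: if Q ∈ ℝ^{n1×n1×n3} satisfies Q^* * Q = I (the identity tensor), then for every X ∈ ℝ^{n1×n2×n3}, ‖Q * X‖_F = ‖X‖_F. -/
open Matrix

/-- The t-product of two real third-order tensors (given by frontal slices):
`(X*Y)^(k) = Σ_j X^(k-j mod n3) · Y^(j)` (0-based indexing). -/
def tProd {n1 n2 l n3 : ℕ} (X : Fin n3 → Matrix (Fin n1) (Fin n2) ℝ)
    (Y : Fin n3 → Matrix (Fin n2) (Fin l) ℝ) : Fin n3 → Matrix (Fin n1) (Fin l) ℝ :=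
  fun k => ∑ j : Fin n3, X (k - j) * Y j

/-- The (conjugate) transpose of a real third-order tensor: the `k`-th frontal slice
(0-based) of `X^*` is the transpose of the `(-k mod n3)`-th frontal slice of `X`. -/
def tConj {n1 n2 n3 : ℕ} (X : Fin n3 → Matrix (Fin n1) (Fin n2) ℝ) :
    Fin n3 → Matrix (Fin n2) (Fin n1) ℝ :=
  fun k => (X (-k))ᵀ

/-- The identity tensor `I_n ∈ ℝ^{n×n×n3}`: its first frontal slice is the `n×n` identity
matrix and all other frontal slices are zero. -/
def idTensor (n n3 : ℕ) : Fin n3 → Matrix (Fin n) (Fin n) ℝ :=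
  fun k => if (k : ℕ) = 0 then 1 else 0

/-- The sum of the squares of the entries of a tensor, as a sum of traces over its frontal slices. -/
theorem sum_sq_eq_sum_trace {n1 n2 n3 : ℕ} (X : Fin n3 → Matrix (Fin n1) (Fin n2) ℝ) :
    ∑ k, ∑ i, ∑ j, X k i j ^ 2 = ∑ k, ((X k)ᵀ * X k).trace := by
  refine Finset.sum_congr rfl fun k _ => ?_
  rw [Finset.sum_comm]
  simp only [trace, diag_apply, mul_apply, transpose_apply, sq]

/-- The shifted Gram sums of the frontal slices of `Q` are the frontal slices of `Q^* * Q`. -/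
theorem sum_transpose_mul_eq_tProd {n1 n2 n3 : ℕ} [NeZero n3]
    (Q : Fin n3 → Matrix (Fin n1) (Fin n2) ℝ) (a b : Fin n3) :
    ∑ k, (Q (k - a))ᵀ * Q (k - b) = tProd (tConj Q) Q (a - b) := by
  rw [← Equiv.sum_comp (Equiv.addRight b)]
  refine Finset.sum_congr rfl fun j _ => ?_
  simp only [Equiv.coe_addRight, add_sub_cancel_right, tConj]
  congr 3
  abel

/-- **Orthogonal tensors preserve the Frobenius norm under the t-product**:
if `Q^* * Q = I` then `‖Q * X‖_F = ‖X‖_F` for every `X`. -/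
theorem frobeniusNorm_tProd_of_orthogonal (n1 n2 n3 : ℕ)
    (Q : Fin n3 → Matrix (Fin n1) (Fin n1) ℝ)
    (hQ : tProd (tConj Q) Q = idTensor n1 n3)
    (X : Fin n3 → Matrix (Fin n1) (Fin n2) ℝ) :
    Real.sqrt (∑ k : Fin n3, ∑ i : Fin n1, ∑ j : Fin n2, (tProd Q X) k i j ^ 2) =
      Real.sqrt (∑ k : Fin n3, ∑ i : Fin n1, ∑ j : Fin n2, X k i j ^ 2) := by
  rcases n3 with _ | m
  · simp
  congr 1
  have hgram (a b : Fin (m + 1)) :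
      ∑ k, (Q (k - a))ᵀ * Q (k - b) = if a = b then 1 else 0 := by
    rw [sum_transpose_mul_eq_tProd, hQ, idTensor]
    simp only [Fin.val_eq_zero_iff, sub_eq_zero]
  rw [sum_sq_eq_sum_trace, sum_sq_eq_sum_trace, ← trace_sum, ← trace_sum]
  congr 1
  calc ∑ k, (tProd Q X k)ᵀ * tProd Q X k
      = ∑ k, ∑ a, ∑ b, (X a)ᵀ * ((Q (k - a))ᵀ * Q (k - b)) * X b := by
        refine Finset.sum_congr rfl fun k _ => ?_
        rw [Finset.sum_comm]
        simp only [tProd, transpose_sum, transpose_mul, Matrix.sum_mul, Matrix.mul_sum,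
          Matrix.mul_assoc]
    _ = ∑ a, ∑ b, (X a)ᵀ * (∑ k, (Q (k - a))ᵀ * Q (k - b)) * X b := by
        rw [Finset.sum_comm]
        refine Finset.sum_congr rfl fun a _ => ?_
        rw [Finset.sum_comm]
        simp only [Matrix.mul_sum, Matrix.sum_mul]
    _ = ∑ a, (X a)ᵀ * X a := by
        refine Finset.sum_congr rfl fun a _ => ?_
        rw [Finset.sum_eq_single a (fun b _ hb => by simp [hgram, hb.symm]) (by simp)]
        simp [hgram]
end

section
/- Existence of the tensor singular value decomposition (t-SVD): for every X ∈ ℝ^{n1×n2×n3} there exist tensors U ∈ ℝ^{n1×n1×n3}, S ∈ ℝ^{n1×n2×n3}, and V ∈ ℝ^{n2×n2×n3} such that X = U * S * V^*, where U and V are orthogonal tensors (U * U^* = U^* * U = I and V * V^* = V^* * V = I) and S is f-diagonal (every frontal slice of S is a diagonal matrix). -/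
open Matrix

/-- A tensor `Q ∈ ℝ^{n×n×n3}` is orthogonal if `Q * Q^* = Q^* * Q = I`. -/
def IsOrthogonalTensor {n n3 : ℕ} (Q : Fin n3 → Matrix (Fin n) (Fin n) ℝ) : Prop :=
  tProd Q (tConj Q) = idTensor n n3 ∧ tProd (tConj Q) Q = idTensor n n3

/-- If `Bᴴ * B` is diagonal and `B` has at least as many rows as columns, then `B` is a unitary
matrix times a rectangular diagonal one. -/
theorem exists_unitary_mul_diag {𝕜 : Type*} [RCLike 𝕜] {m n : ℕ} (hnm : n ≤ m)
    (B : Matrix (Fin m) (Fin n) 𝕜) (hB : (Bᴴ * B).IsDiag) :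
    ∃ U ∈ unitaryGroup (Fin m) 𝕜, ∃ S : Matrix (Fin m) (Fin n) 𝕜,
      B = U * S ∧ ∀ (i : Fin m) (j : Fin n), (i : ℕ) ≠ (j : ℕ) → S i j = 0 := by
  let c : Fin n → EuclideanSpace 𝕜 (Fin m) := fun j => WithLp.toLp 2 (fun i => B i j)
  have hc (i j) (hij : i ≠ j) : inner 𝕜 (c i) (c j) = 0 := by
    rw [← hB hij, EuclideanSpace.inner_toLp_toLp, dotProduct_comm]
    rfl
  let w : Fin m → EuclideanSpace 𝕜 (Fin m) := fun i =>
    if h : (i : ℕ) < n then ((‖c ⟨i, h⟩‖⁻¹ : ℝ) : 𝕜) • c ⟨i, h⟩ else 0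
  let s : Set (Fin m) := {i | ∃ h : (i : ℕ) < n, c ⟨i, h⟩ ≠ 0}
  have hw : Orthonormal 𝕜 (s.domRestrict w) := by
    refine ⟨?_, ?_⟩
    · rintro ⟨i, h, hi⟩
      simp [w, h, norm_smul, hi]
    · rintro ⟨i, h, hi⟩ ⟨j, h', hj⟩ hij
      have : (⟨i, h⟩ : Fin n) ≠ ⟨j, h'⟩ := by
        simpa [Fin.ext_iff] using hij
      simp [w, h, h', inner_smul_left, inner_smul_right, hc _ _ this]
  obtain ⟨b, hb⟩ := hw.exists_orthonormalBasis_extension_of_card_eq (by simp)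
  refine ⟨_, (EuclideanSpace.basisFun (Fin m) 𝕜).toMatrix_orthonormalBasis_mem_unitary b,
    Matrix.of fun i j => if (i : ℕ) = j then (‖c j‖ : 𝕜) else 0, ?_, ?_⟩
  · ext i j
    rw [Matrix.mul_apply, Finset.sum_eq_single (Fin.castLE hnm j)]
    · by_cases hj : c j = 0
      · have : B i j = c j i := rfl
        simp [this, hj]
      · have hbj := hb (Fin.castLE hnm j) ⟨j.2, hj⟩
        have hn : (‖c j‖ : 𝕜) ≠ 0 := by simpa using hj
        simp [Module.Basis.toMatrix_apply, hbj, w]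
        field_simp
        rfl
    · intro k _ hk
      have : (k : ℕ) ≠ j := fun h => hk (Fin.ext h)
      simp [this]
    · simp
  · intro i j hij
    simp [hij]

/-- **Singular value decomposition** of a real or complex matrix. -/
theorem exists_svd {𝕜 : Type*} [RCLike 𝕜] {m n : ℕ} (A : Matrix (Fin m) (Fin n) 𝕜) :
    ∃ U ∈ unitaryGroup (Fin m) 𝕜, ∃ S : Matrix (Fin m) (Fin n) 𝕜,
      ∃ V ∈ unitaryGroup (Fin n) 𝕜,
        A = U * S * Vᴴ ∧ ∀ (i : Fin m) (j : Fin n), (i : ℕ) ≠ (j : ℕ) → S i j = 0 := by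
  wlog hnm : n ≤ m generalizing m n
  · obtain ⟨U, hU, S, V, hV, h, hS⟩ := this Aᴴ (Nat.le_of_not_le hnm)
    refine ⟨V, hV, Sᴴ, U, hU, ?_, fun i j hij => by simp [hS j i hij.symm]⟩
    rw [← conjTranspose_conjTranspose A, h]
    simp [Matrix.mul_assoc]
  have hH := isHermitian_conjTranspose_mul_self A
  let V : Matrix (Fin n) (Fin n) 𝕜 := (hH.eigenvectorUnitary : Matrix (Fin n) (Fin n) 𝕜)
  have hVm : V ∈ unitaryGroup (Fin n) 𝕜 := hH.eigenvectorUnitary.2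
  obtain ⟨U, hU, S, h, hS⟩ := exists_unitary_mul_diag hnm (A * V) (by
    have := hH.conjStarAlgAut_star_eigenvectorUnitary
    rw [Unitary.conjStarAlgAut_star_apply] at this
    rw [conjTranspose_mul, Matrix.mul_assoc, ← Matrix.mul_assoc Aᴴ, ← Matrix.mul_assoc,
      ← star_eq_conjTranspose V, this]
    exact isDiag_diagonal _)
  refine ⟨U, hU, S, V, hVm, ?_, hS⟩
  rw [← h, Matrix.mul_assoc, ← star_eq_conjTranspose, mem_unitaryGroup_iff.1 hVm, Matrix.mul_one]

/-- The entrywise complex conjugate of a complex matrix. -/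
abbrev Matrix.conj {m n : ℕ} (A : Matrix (Fin m) (Fin n) ℂ) : Matrix (Fin m) (Fin n) ℂ :=
  A.map (starRingEnd ℂ)

/-- `(U, S, V)` is a singular value decomposition of `A`. -/
structure IsSVD {m n : ℕ} (A : Matrix (Fin m) (Fin n) ℂ) (U : Matrix (Fin m) (Fin m) ℂ)
    (S : Matrix (Fin m) (Fin n) ℂ) (V : Matrix (Fin n) (Fin n) ℂ) : Prop where
  left_mem : U ∈ unitaryGroup (Fin m) ℂ
  right_mem : V ∈ unitaryGroup (Fin n) ℂ
  eq_mul : A = U * S * Vᴴ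
  diag : ∀ (i : Fin m) (j : Fin n), (i : ℕ) ≠ (j : ℕ) → S i j = 0

theorem Matrix.map_mem_unitaryGroup {𝕜 𝕜' : Type*} [RCLike 𝕜] [RCLike 𝕜'] {n : ℕ} (f : 𝕜 →+* 𝕜')
    (hf : ∀ x, f (star x) = star (f x)) {U : Matrix (Fin n) (Fin n) 𝕜}
    (hU : U ∈ unitaryGroup (Fin n) 𝕜) : U.map f ∈ unitaryGroup (Fin n) 𝕜' := by
  rw [mem_unitaryGroup_iff] at hU ⊢
  rw [star_eq_conjTranspose, ← conjTranspose_map f hf, ← Matrix.map_mul,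
    ← star_eq_conjTranspose, hU, Matrix.map_one _ (map_zero f) (map_one f)]

theorem IsSVD.conj {m n : ℕ} {A : Matrix (Fin m) (Fin n) ℂ} {U S V} (h : IsSVD A U S V) :
    IsSVD A.conj U.conj S.conj V.conj where
  left_mem := map_mem_unitaryGroup _ (fun _ => rfl) h.left_mem
  right_mem := map_mem_unitaryGroup _ (fun _ => rfl) h.right_mem
  eq_mul := by
    rw [h.eq_mul]
    simp only [Matrix.conj, Matrix.map_mul]
    rfl
  diag i j hij := by simp [h.diag i j hij]

/-- A conjugate-symmetric family of complex matrices has a conjugate-symmetric family of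
singular value decompositions. -/
theorem exists_conj_symm_svd {m n N : ℕ} [NeZero N] (A : ZMod N → Matrix (Fin m) (Fin n) ℂ)
    (hA : ∀ s, A (-s) = (A s).conj) :
    ∃ (U : ZMod N → Matrix (Fin m) (Fin m) ℂ) (S : ZMod N → Matrix (Fin m) (Fin n) ℂ)
      (V : ZMod N → Matrix (Fin n) (Fin n) ℂ), (∀ s, IsSVD (A s) (U s) (S s) (V s)) ∧ (∀ s, U (-s) = (U s).conj) ∧
      (∀ s, S (-s) = (S s).conj) ∧ ∀ s, V (-s) = (V s).conj := by
  have conj_conj {m n : ℕ} (B : Matrix (Fin m) (Fin n) ℂ) : B.conj.conj = B := by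
    ext; simp
  have key (s : ZMod N) : ∃ T : Matrix (Fin m) (Fin m) ℂ × Matrix (Fin m) (Fin n) ℂ ×
      Matrix (Fin n) (Fin n) ℂ, IsSVD (A s) T.1 T.2.1 T.2.2 ∧
        (-s = s → T.1 = T.1.conj ∧ T.2.1 = T.2.1.conj ∧ T.2.2 = T.2.2.conj) := by
    by_cases hs : -s = s
    · have hreal : A s = ((A s).map Complex.re).map Complex.ofRealHom := by
        have := hA s
        rw [hs] at this
        ext i j
        have := congr_fun₂ this i j
        exact (Complex.conj_eq_iff_re.1 this.symm).symm
      obtain ⟨U, hU, S, V, hV, h, hS⟩ := exists_svd ((A s).map Complex.re)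
      refine ⟨(U.map Complex.ofRealHom, S.map Complex.ofRealHom, V.map Complex.ofRealHom),
        ⟨map_mem_unitaryGroup _ (fun _ => by simp) hU, map_mem_unitaryGroup _ (fun _ => by simp) hV, ?_,
          fun i j hij => by simp [hS i j hij]⟩, fun _ => ⟨?_, ?_, ?_⟩⟩
      · rw [hreal, h, Matrix.map_mul, Matrix.map_mul, conjTranspose_map _ fun _ => by simp]
      all_goals ext; simp
    · obtain ⟨U, hU, S, V, hV, h, hS⟩ := exists_svd (A s)
      exact ⟨(U, S, V), ⟨hU, hV, h, hS⟩, fun h => absurd h hs⟩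
  choose T hT hT' using key
  let sel {α : Type} (f : ZMod N → α) (c : α → α) (s : ZMod N) : α :=
    if s.val ≤ (-s).val then f s else c (f (-s))
  have hsel {α : Type} (f : ZMod N → α) (c : α → α) (hc : ∀ a, c (c a) = a)
      (hf : ∀ s, -s = s → f s = c (f s)) (s : ZMod N) : sel f c (-s) = c (sel f c s) := by
    rcases lt_trichotomy s.val (-s).val with h | h | h
    · simp [sel, h.le, h.not_ge]
    · have := (ZMod.val_injective N h).symm
      simpa [sel, this] using hf s this
    · simp [sel, h.le, h.not_ge, hc]
  refine ⟨sel (fun s => (T s).1) Matrix.conj, sel (fun s => (T s).2.1) Matrix.conj,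
    sel (fun s => (T s).2.2) Matrix.conj, fun s => ?_,
    hsel _ _ conj_conj fun s hs => (hT' s hs).1, hsel _ _ conj_conj fun s hs => (hT' s hs).2.1,
    hsel _ _ conj_conj fun s hs => (hT' s hs).2.2⟩
  by_cases h : s.val ≤ (-s).val
  · simpa only [sel, if_pos h] using hT s
  · have := (hT (-s)).conj
    rw [hA, conj_conj] at this
    simpa only [sel, if_neg h] using this

/-- The discrete Fourier transform of a real tensor along its third dimension. -/
noncomputable def tFourier {n1 n2 m : ℕ} (X : Fin (m + 1) → Matrix (Fin n1) (Fin n2) ℝ) :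
    ZMod (m + 1) → Matrix (Fin n1) (Fin n2) ℂ :=
  ZMod.dft fun k : ZMod (m + 1) => (X k).map Complex.ofRealHom

theorem ZMod.star_stdAddChar {N : ℕ} [NeZero N] (s : ZMod N) :
    starRingEnd ℂ (ZMod.stdAddChar s) = ZMod.stdAddChar (-s) := by
  rw [ZMod.stdAddChar_apply, ZMod.stdAddChar_apply, AddChar.map_neg_eq_inv, Circle.coe_inv_eq_conj]

theorem ZMod.dft_conj {n1 n2 N : ℕ} [NeZero N] (Y : ZMod N → Matrix (Fin n1) (Fin n2) ℂ)
    (s : ZMod N) : ZMod.dft (fun k => (Y k).conj) s = (ZMod.dft Y (-s)).conj := by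
  ext i j
  simp [ZMod.dft_apply, Matrix.sum_apply, ZMod.star_stdAddChar]

/-- The discrete Fourier transform turns circular convolution into multiplication. -/
theorem ZMod.dft_matrix_conv {n1 n2 n3 N : ℕ} [NeZero N]
    (X : ZMod N → Matrix (Fin n1) (Fin n2) ℂ) (Y : ZMod N → Matrix (Fin n2) (Fin n3) ℂ)
    (s : ZMod N) :
    ZMod.dft (fun k => ∑ j, X (k - j) * Y j) s = ZMod.dft X s * ZMod.dft Y s := by
  simp only [ZMod.dft_apply, Finset.smul_sum]
  rw [Finset.sum_comm, Matrix.mul_sum]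
  refine Finset.sum_congr rfl fun j _ => ?_
  rw [Matrix.sum_mul, ← Equiv.sum_comp (Equiv.addRight j)]
  refine Finset.sum_congr rfl fun k _ => ?_
  simp only [Equiv.coe_addRight, add_sub_cancel_right, add_mul, neg_add, AddChar.map_add_eq_mul,
    Matrix.smul_mul, Matrix.mul_smul, smul_smul]
  rw [mul_comm]

theorem ZMod.dft_conjTranspose_neg {n1 n2 N : ℕ} [NeZero N]
    (X : ZMod N → Matrix (Fin n1) (Fin n2) ℂ) (s : ZMod N) :
    ZMod.dft (fun k => (X (-k))ᴴ) s = (ZMod.dft X s)ᴴ := by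
  simp only [ZMod.dft_apply]
  rw [← Equiv.sum_comp (Equiv.neg (ZMod N)), conjTranspose_sum]
  refine Finset.sum_congr rfl fun k _ => ?_
  ext i j
  simp [ZMod.star_stdAddChar]

section tFourier

variable {n1 n2 n3 m : ℕ}

theorem tFourier_neg (X : Fin (m + 1) → Matrix (Fin n1) (Fin n2) ℝ) (s : ZMod (m + 1)) :
    tFourier X (-s) = (tFourier X s).conj := by
  have h (k : Fin (m + 1)) :
      ((X k).map Complex.ofRealHom).conj = (X k).map Complex.ofRealHom := by
    ext
    simp
  have := ZMod.dft_conj (fun k : ZMod (m + 1) => (X k).map Complex.ofRealHom) (-s)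
  rw [neg_neg] at this
  exact (congrArg (ZMod.dft (N := m + 1) · (-s)) (funext h)).symm.trans this

theorem tFourier_injective :
    Function.Injective (tFourier : (Fin (m + 1) → Matrix (Fin n1) (Fin n2) ℝ) → _) := by
  intro X Y h
  have := ZMod.dft.injective h
  funext k
  exact Matrix.map_injective Complex.ofReal_injective (congr_fun this k)

theorem exists_tFourier_eq (F : ZMod (m + 1) → Matrix (Fin n1) (Fin n2) ℂ)
    (hF : ∀ s, F (-s) = (F s).conj) :
    ∃ X : Fin (m + 1) → Matrix (Fin n1) (Fin n2) ℝ, tFourier X = F ∧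
      ∀ i j, (∀ s, F s i j = 0) → ∀ k, X k i j = 0 := by
  let Y := ZMod.dft.symm F
  have hY : (fun k => (Y k).conj) = Y := by
    apply ZMod.dft.injective
    funext s
    rw [ZMod.dft_conj]
    simp only [Y, LinearEquiv.apply_symm_apply, hF]
    ext; simp
  refine ⟨fun k => (Y k).map Complex.re, ?_, fun i j h k => ?_⟩
  · rw [tFourier, ← LinearEquiv.eq_symm_apply]
    funext k
    ext i j
    exact Complex.conj_eq_iff_re.1 (congr_fun₂ (congr_fun hY k) i j)
  · have (k : ZMod (m + 1)) : Y k i j = 0 := by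
      simp [Y, ZMod.invDFT_apply, Matrix.sum_apply, h]
    exact congrArg Complex.re (this k)

theorem tFourier_tProd (X : Fin (m + 1) → Matrix (Fin n1) (Fin n2) ℝ)
    (Y : Fin (m + 1) → Matrix (Fin n2) (Fin n3) ℝ) (s : ZMod (m + 1)) :
    tFourier (tProd X Y) s = tFourier X s * tFourier Y s := by
  let X' : ZMod (m + 1) → Matrix (Fin n1) (Fin n2) ℂ := fun k => (X k).map Complex.ofRealHom
  let Y' : ZMod (m + 1) → Matrix (Fin n2) (Fin n3) ℂ := fun k => (Y k).map Complex.ofRealHom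
  have h (k : Fin (m + 1)) : (tProd X Y k).map Complex.ofRealHom =
      ∑ j, (X (k - j)).map Complex.ofRealHom * (Y j).map Complex.ofRealHom := by
    ext
    simp [tProd, Matrix.sum_apply, Matrix.mul_apply]
  have h' : (fun k : ZMod (m + 1) => (tProd X Y k).map Complex.ofRealHom) =
      fun k => ∑ j, X' (k - j) * Y' j := funext h
  rw [tFourier, h', ZMod.dft_matrix_conv]
  rfl

theorem tFourier_tConj (X : Fin (m + 1) → Matrix (Fin n1) (Fin n2) ℝ) (s : ZMod (m + 1)) :
    tFourier (tConj X) s = (tFourier X s)ᴴ := by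
  let X' : ZMod (m + 1) → Matrix (Fin n1) (Fin n2) ℂ := fun k => (X k).map Complex.ofRealHom
  have h (k : Fin (m + 1)) : (tConj X k).map Complex.ofRealHom =
      ((X (-k)).map Complex.ofRealHom)ᴴ := by
    ext
    simp [tConj]
  have h' : (fun k : ZMod (m + 1) => (tConj X k).map Complex.ofRealHom) =
      fun k => (X' (-k))ᴴ := funext h
  rw [tFourier, h', ZMod.dft_conjTranspose_neg]
  rfl

theorem tFourier_idTensor (s : ZMod (m + 1)) : tFourier (idTensor n1 (m + 1)) s = 1 := by
  have h (k : Fin (m + 1)) : (idTensor n1 (m + 1) k).map Complex.ofRealHom =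
      if k = 0 then 1 else 0 := by
    by_cases hk : k = 0
    · simp [idTensor, hk]
    · simp [idTensor, hk]
  refine (congrArg (ZMod.dft · s) (funext h)).trans
    ((ZMod.dft_apply (N := m + 1) (fun k => if k = 0 then 1 else 0) s).trans ?_)
  simp

theorem isOrthogonalTensor_of_tFourier {Q : Fin (m + 1) → Matrix (Fin n1) (Fin n1) ℝ}
    (hQ : ∀ s, tFourier Q s ∈ unitaryGroup (Fin n1) ℂ) : IsOrthogonalTensor Q := by
  constructor <;> apply tFourier_injective <;> funext s <;>
    rw [tFourier_tProd, tFourier_tConj, tFourier_idTensor, ← star_eq_conjTranspose]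
  · exact mem_unitaryGroup_iff.1 (hQ s)
  · exact mem_unitaryGroup_iff'.1 (hQ s)

end tFourier

/-- **Existence of the tensor singular value decomposition (t-SVD)**:
every `X ∈ ℝ^{n1×n2×n3}` factors as `X = U * S * V^*` with `U`, `V` orthogonal tensors
and `S` f-diagonal (every frontal slice diagonal). -/
theorem exists_tSVD (n1 n2 n3 : ℕ) (X : Fin n3 → Matrix (Fin n1) (Fin n2) ℝ) :
    ∃ (U : Fin n3 → Matrix (Fin n1) (Fin n1) ℝ)
      (S : Fin n3 → Matrix (Fin n1) (Fin n2) ℝ)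
      (V : Fin n3 → Matrix (Fin n2) (Fin n2) ℝ),
      X = tProd (tProd U S) (tConj V) ∧
      IsOrthogonalTensor U ∧ IsOrthogonalTensor V ∧
      ∀ (k : Fin n3) (i : Fin n1) (j : Fin n2), (i : ℕ) ≠ (j : ℕ) → S k i j = 0 := by
  obtain _ | m := n3
  · refine ⟨fun k => k.elim0, fun k => k.elim0, fun k => k.elim0, ?_, ⟨?_, ?_⟩, ⟨?_, ?_⟩,
      fun k => k.elim0⟩ <;> exact funext fun k => k.elim0
  obtain ⟨U', S', V', h, hU, hS, hV⟩ := exists_conj_symm_svd (tFourier X) (tFourier_neg X)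
  obtain ⟨U, rfl, -⟩ := exists_tFourier_eq U' hU
  obtain ⟨S, rfl, hS0⟩ := exists_tFourier_eq S' hS
  obtain ⟨V, rfl, -⟩ := exists_tFourier_eq V' hV
  refine ⟨U, S, V, tFourier_injective (funext fun s => ?_),
    isOrthogonalTensor_of_tFourier fun s => (h s).left_mem,
    isOrthogonalTensor_of_tFourier fun s => (h s).right_mem,
    fun k i j hij => hS0 i j (fun s => (h s).diag i j hij) k⟩
  rw [tFourier_tProd, tFourier_tProd, tFourier_tConj]
  exact (h s).eq_mul
end

section
/- Existence of the tensor QR decomposition (t-QR): for every X ∈ ℝ^{n1×n2×n3} there exist tensors Q ∈ ℝ^{n1×n1×n3} and R ∈ ℝ^{n1×n2×n3} such that X = Q * R, where Q is an orthogonal tensor (Q * Q^* = Q^* * Q = I) and every frontal slice of R is upper triangular (R^{(k)}_{ij} = 0 whenever i > j, for all k = 1,…,n3). -/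
open Matrix

open scoped Matrix.Norms.Operator in
theorem Matrix.hasDerivAt_exp_smul_mulVec {ι : Type*} [Fintype ι] [DecidableEq ι]
    (K : Matrix ι ι ℝ) (w : ι → ℝ) (p : ι) :
    HasDerivAt (fun t : ℝ => (NormedSpace.exp (t • K) *ᵥ w) p) ((K *ᵥ w) p) 0 := by
  have h := hasDerivAt_exp_smul_const (𝕂 := ℝ) K (0 : ℝ)
  rw [zero_smul, NormedSpace.exp_zero, one_mul] at h
  let L : Matrix ι ι ℝ →L[ℝ] ℝ := LinearMap.toContinuousLinearMap
    ((LinearMap.proj p).comp ((Matrix.mulVecBilin ℝ ℝ).flip w))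
  exact L.hasFDerivAt.comp_hasDerivAt (0 : ℝ) h

open scoped Matrix.Norms.Operator in
theorem Matrix.exp_mulVec_of_mulVec_eq_zero {ι : Type*} [Fintype ι] [DecidableEq ι]
    {K : Matrix ι ι ℝ} {y : ι → ℝ} (hy : K *ᵥ y = 0) : NormedSpace.exp K *ᵥ y = y := by
  let L : Matrix ι ι ℝ →L[ℝ] (ι → ℝ) := LinearMap.toContinuousLinearMap
    ((Matrix.mulVecBilin ℝ ℝ).flip y)
  have h := L.hasSum (NormedSpace.exp_series_hasSum_exp' (𝕂 := ℝ) K)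
  have h0 := hasSum_single (f := fun n : ℕ => L (((n.factorial : ℝ)⁻¹) • K ^ n)) 0 (by
    intro n hn
    obtain ⟨m, rfl⟩ := Nat.exists_eq_succ_of_ne_zero hn
    change ((((m + 1).factorial : ℝ)⁻¹) • K ^ (m + 1)) *ᵥ y = 0
    rw [smul_mulVec, pow_succ, ← mulVec_mulVec, hy, mulVec_zero, smul_zero])
  have := h.unique h0
  change _ *ᵥ y = ((((0).factorial : ℝ)⁻¹) • K ^ 0) *ᵥ y at this
  exact this.trans (by simp)

open scoped Matrix.Norms.Operator in
theorem Matrix.exp_submatrix_equiv {ι : Type*} [Fintype ι] [DecidableEq ι] (K : Matrix ι ι ℝ)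
    (e : ι ≃ ι) :
    (NormedSpace.exp K).submatrix e e = NormedSpace.exp (K.submatrix e e) :=
  NormedSpace.map_exp (reindexAlgEquiv ℝ ℝ e.symm) (continuous_id.matrix_submatrix _ _) K

/-- If `K` is skew-symmetric then `exp K` is orthogonal. -/
theorem Matrix.exp_mul_transpose_exp_of_transpose_eq_neg {ι : Type*} [Fintype ι] [DecidableEq ι]
    {K : Matrix ι ι ℝ} (hK : Kᵀ = -K) :
    NormedSpace.exp K * (NormedSpace.exp K)ᵀ = 1 := by
  rw [← exp_transpose, hK, exp_neg]
  exact mul_nonsing_inv _ ((isUnit_iff_isUnit_det _).1 (isUnit_exp K))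

theorem Matrix.isCompact_setOf_mul_transpose_eq_one {ι : Type*} [Fintype ι] [DecidableEq ι] :
    IsCompact {U : Matrix ι ι ℝ | U * Uᵀ = 1} := by
  have hbox : IsCompact (Set.univ.pi fun _ : ι => Set.univ.pi fun _ : ι => Set.Icc (-1 : ℝ) 1) :=
    isCompact_univ_pi fun _ => isCompact_univ_pi fun _ => isCompact_Icc
  refine hbox.of_isClosed_subset (t := {U : Matrix ι ι ℝ | U * Uᵀ = 1}) ?_ ?_
  · exact isClosed_eq (by fun_prop) continuous_const
  · intro U hU i _ j _
    have := entry_norm_bound_of_unitary (𝕜 := ℝ) (U := U)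
      (mem_unitaryGroup_iff.2 (by simpa [star_eq_conjTranspose] using hU)) i j
    exact abs_le.1 this

/-- Translation by `c` in the second index. -/
def blockShift (m : Type*) {G : Type*} [AddGroup G] (c : G) : m × G ≃ m × G :=
  (Equiv.refl m).prodCongr (Equiv.addRight c)

/-- A matrix whose block in position `(a, b)` depends only on `a - b`. -/
def IsBlockCirculant {m G : Type*} [AddGroup G] (M : Matrix (m × G) (m × G) ℝ) : Prop :=
  ∀ c, M.submatrix (blockShift m c) (blockShift m c) = M

theorem IsBlockCirculant.apply_add {m G : Type*} [AddGroup G] {M : Matrix (m × G) (m × G) ℝ}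
    (h : IsBlockCirculant M) (c : G) (i j : m) (a b : G) :
    M (i, a + c) (j, b + c) = M (i, a) (j, b) :=
  congrFun (congrFun (h c) (i, a)) (j, b)

section

variable {n1 n2 : ℕ} {G : Type*} [AddGroup G]

/-- A skew-symmetric block-circulant matrix coupling the blocks `p` and `q` through `v`. -/
def blockRotationGenerator (p q : Fin n1) (v : G → ℝ) : Matrix (Fin n1 × G) (Fin n1 × G) ℝ :=
  let A : Matrix (Fin n1 × G) (Fin n1 × G) ℝ :=
    of fun s t => if s.1 = p ∧ t.1 = q then v (t.2 - s.2) else 0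
  A - Aᵀ

theorem isBlockCirculant_blockRotationGenerator (p q : Fin n1) (v : G → ℝ) :
    IsBlockCirculant (blockRotationGenerator p q v) := by
  intro c
  ext ⟨i, a⟩ ⟨j, b⟩
  simp [blockRotationGenerator, blockShift]

theorem transpose_blockRotationGenerator (p q : Fin n1) (v : G → ℝ) :
    (blockRotationGenerator p q v)ᵀ = -blockRotationGenerator p q v := by
  simp [blockRotationGenerator]

variable [Fintype G]

theorem blockRotationGenerator_mulVec_eq_zero {p q : Fin n1} (v : G → ℝ) {y : Fin n1 × G → ℝ}
    (hp : ∀ a, y (p, a) = 0) (hq : ∀ a, y (q, a) = 0) :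
    blockRotationGenerator p q v *ᵥ y = 0 := by
  ext ⟨i, a⟩
  refine Finset.sum_eq_zero ?_
  rintro ⟨j, b⟩ -
  by_cases hjp : j = p
  · simp [hjp, hp]
  by_cases hjq : j = q
  · simp [hjq, hq]
  simp [blockRotationGenerator, hjp, hjq]

theorem blockRotationGenerator_mulVec_apply {p q : Fin n1} (hpq : p ≠ q) (v : G → ℝ)
    (w : Fin n1 × G → ℝ) :
    (blockRotationGenerator p q v *ᵥ w) (p, 0) = ∑ b, v b * w (q, b) := by
  rw [mulVec, dotProduct, Fintype.sum_prod_type, Finset.sum_eq_single q]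
  · simp [blockRotationGenerator, hpq]
  · intro j _ hj
    simp [blockRotationGenerator, hpq, hj]
  · simp

variable [DecidableEq G]

/-- The orthogonal block-circulant matrices that annihilate the subdiagonal blocks of the first `k`
columns of `x`. -/
def partialTriangularizers (x : Fin n2 → Fin n1 × G → ℝ) (k : ℕ) :
    Set (Matrix (Fin n1 × G) (Fin n1 × G) ℝ) :=
  {U | U * Uᵀ = 1 ∧ IsBlockCirculant U ∧
    ∀ (i : Fin n1) (j : Fin n2) (a : G), (j : ℕ) < k → (j : ℕ) < i → (U *ᵥ x j) (i, a) = 0}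

theorem isCompact_partialTriangularizers (x : Fin n2 → Fin n1 × G → ℝ) (k : ℕ) :
    IsCompact (partialTriangularizers x k) := by
  refine isCompact_setOf_mul_transpose_eq_one.inter_right (IsClosed.inter ?_ ?_)
  · change IsClosed {M : Matrix (Fin n1 × G) (Fin n1 × G) ℝ | ∀ c,
      M.submatrix (blockShift _ c) (blockShift _ c) = M}
    simp only [Set.ofPred_forall]
    exact isClosed_iInter fun c => isClosed_eq (by fun_prop) continuous_id
  · change IsClosed {U : Matrix (Fin n1 × G) (Fin n1 × G) ℝ | ∀ (i : Fin n1) (j : Fin n2) (a : G),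
      (j : ℕ) < k → (j : ℕ) < i → (U *ᵥ x j) (i, a) = 0}
    simp only [Set.ofPred_forall]
    refine isClosed_iInter fun i => isClosed_iInter fun j => isClosed_iInter fun a =>
      isClosed_iInter fun _ => isClosed_iInter fun _ => isClosed_eq ?_ continuous_const
    exact (continuous_apply (i, a)).comp (continuous_id.matrix_mulVec continuous_const)

theorem exp_mul_mem_partialTriangularizers {x : Fin n2 → Fin n1 × G → ℝ} {k : ℕ}
    {U : Matrix (Fin n1 × G) (Fin n1 × G) ℝ} (hU : U ∈ partialTriangularizers x k)
    {p q : Fin n1} (hp : k ≤ p) (hq : k ≤ q) (v : G → ℝ) (t : ℝ) :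
    NormedSpace.exp (t • blockRotationGenerator p q v) * U ∈ partialTriangularizers x k := by
  obtain ⟨hU1, hU2, hU3⟩ := hU
  set K := blockRotationGenerator p q v with hK
  refine ⟨?_, ?_, ?_⟩
  · rw [transpose_mul, Matrix.mul_assoc, ← Matrix.mul_assoc U, hU1, Matrix.one_mul]
    apply exp_mul_transpose_exp_of_transpose_eq_neg
    rw [transpose_smul, hK, transpose_blockRotationGenerator, smul_neg]
  · intro c
    rw [← submatrix_mul_equiv _ _ _ (blockShift _ c), hU2 c, exp_submatrix_equiv]
    congr 2
    exact congrArg (t • ·) (isBlockCirculant_blockRotationGenerator p q v c)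
  · intro i j a hjk hji
    rw [← mulVec_mulVec, exp_mulVec_of_mulVec_eq_zero, hU3 i j a hjk hji]
    rw [smul_mulVec, hK, blockRotationGenerator_mulVec_eq_zero, smul_zero]
    · exact fun a => hU3 p j a hjk (hjk.trans_le hp)
    · exact fun a => hU3 q j a hjk (hjk.trans_le hq)

/-- A maximizer of the `(k, 0)` entry of `U *ᵥ x k` among the partial triangularizers of `k` columns
triangularizes `k + 1` columns, since the derivatives along all rotations vanish. -/
theorem partialTriangularizers_succ_nonempty {x : Fin n2 → Fin n1 × G → ℝ} {k : ℕ}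
    (h : (partialTriangularizers x k).Nonempty) :
    (partialTriangularizers x (k + 1)).Nonempty := by
  by_cases hk : k < n1 ∧ k < n2
  · obtain ⟨hk1, hk2⟩ := hk
    let p : Fin n1 := ⟨k, hk1⟩
    let j₀ : Fin n2 := ⟨k, hk2⟩
    obtain ⟨U, hU, hmax⟩ := (isCompact_partialTriangularizers x k).exists_isMaxOn h
      (f := fun U => (U *ᵥ x j₀) (p, 0))
      ((continuous_apply (p, (0 : G))).comp
        (continuous_id.matrix_mulVec continuous_const)).continuousOn
    refine ⟨U, hU.1, hU.2.1, fun q j a hj hjq => ?_⟩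
    rcases Nat.lt_succ_iff_lt_or_eq.1 hj with hj | hj
    · exact hU.2.2 q j a hj hjq
    obtain rfl : j = j₀ := Fin.ext hj
    have hpq : p ≠ q := fun e => by
      rw [← e] at hjq
      exact lt_irrefl _ hjq
    set w := U *ᵥ x j₀ with hw
    let K := blockRotationGenerator p q fun b => w (q, b)
    have hder := hasDerivAt_exp_smul_mulVec K w (p, 0)
    have hloc : IsLocalMax (fun t : ℝ => (NormedSpace.exp (t • K) *ᵥ w) (p, 0)) 0 := by
      refine Filter.Eventually.of_forall fun t => ?_
      have := hmax (exp_mul_mem_partialTriangularizers hU (p := p) (q := q) le_rfl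
        (le_of_lt hjq) (fun b => w (q, b)) t)
      simpa [← mulVec_mulVec, ← hw, K] using this
    have hzero := hloc.hasDerivAt_eq_zero hder
    rw [blockRotationGenerator_mulVec_apply hpq,
      Finset.sum_eq_zero_iff_of_nonneg fun b _ => mul_self_nonneg _] at hzero
    exact mul_self_eq_zero.1 (hzero a (Finset.mem_univ a))
  · obtain ⟨U, hU1, hU2, hU3⟩ := h
    refine ⟨U, hU1, hU2, fun i j a hj hji => hU3 i j a ?_ hji⟩
    have := i.2
    have := j.2
    omega

theorem partialTriangularizers_nonempty (x : Fin n2 → Fin n1 × G → ℝ) (k : ℕ) :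
    (partialTriangularizers x k).Nonempty := by
  induction k with
  | zero =>
    exact ⟨1, by simp, fun c => submatrix_one_equiv _, fun i j a h => absurd h (Nat.not_lt_zero _)⟩
  | succ k ih => exact partialTriangularizers_succ_nonempty ih

end

/-- **Existence of the tensor QR decomposition (t-QR)**: every `X ∈ ℝ^{n1×n2×n3}`
factors as `X = Q * R` with `Q` an orthogonal tensor and every frontal slice of `R`
upper triangular. -/
theorem exists_tQR (n1 n2 n3 : ℕ) (X : Fin n3 → Matrix (Fin n1) (Fin n2) ℝ) :
    ∃ (Q : Fin n3 → Matrix (Fin n1) (Fin n1) ℝ)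
      (R : Fin n3 → Matrix (Fin n1) (Fin n2) ℝ),
      X = tProd Q R ∧ IsOrthogonalTensor Q ∧
      ∀ (k : Fin n3) (i : Fin n1) (j : Fin n2), (j : ℕ) < (i : ℕ) → R k i j = 0 := by
  rcases Nat.eq_zero_or_pos n3 with rfl | hn3
  · exact ⟨fun k => k.elim0, fun k => k.elim0, funext fun k => k.elim0,
      ⟨funext fun k => k.elim0, funext fun k => k.elim0⟩, fun k => k.elim0⟩
  have : NeZero n3 := ⟨hn3.ne'⟩
  let x : Fin n2 → Fin n1 × Fin n3 → ℝ := fun j s => X s.2 s.1 j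
  obtain ⟨U, hU, hcirc, htri⟩ := partialTriangularizers_nonempty x n2
  have hU' : Uᵀ * U = 1 := mul_eq_one_comm.1 hU
  have hsub (i j : Fin n1) (a b : Fin n3) : U (j, -(a - b)) (i, 0) = U (j, b) (i, a) := by
    simpa using (hcirc.apply_add a j i (-(a - b)) 0).symm
  have hneg (i j : Fin n1) (b : Fin n3) : U (j, -b) (i, 0) = U (j, 0) (i, b) := by
    simpa using hsub i j b 0
  have hid (i j : Fin n1) (a : Fin n3) :
      (1 : Matrix (Fin n1 × Fin n3) (Fin n1 × Fin n3) ℝ) (i, a) (j, 0) =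
        idTensor n1 n3 a i j := by
    have ha : (a : ℕ) = 0 ↔ a = 0 := by rw [Fin.ext_iff, Fin.val_zero]
    by_cases h : a = 0 <;> simp [idTensor, ha, h, one_apply]
  refine ⟨fun c => of fun i j => U (j, -c) (i, 0), fun a => of fun i j => (U *ᵥ x j) (i, a),
    ?_, ⟨?_, ?_⟩, fun a i j hji => htri i j a j.2 hji⟩
  · ext a i j
    have h : (Uᵀ *ᵥ (U *ᵥ x j)) (i, a) = X a i j := by
      rw [mulVec_mulVec, hU', one_mulVec]
    rw [← h, mulVec, dotProduct, Fintype.sum_prod_type_right]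
    simp only [tProd, Matrix.sum_apply, mul_apply, of_apply, hsub, transpose_apply]
  · ext a i j
    rw [← hid, ← hU', mul_apply, Fintype.sum_prod_type_right]
    simp only [tProd, tConj, Matrix.sum_apply, mul_apply, of_apply, hsub, transpose_apply, neg_neg]
  · ext a i j
    rw [← hid, ← hU, mul_apply, Fintype.sum_prod_type_right]
    simp only [tProd, tConj, Matrix.sum_apply, mul_apply, of_apply, transpose_apply]
    refine Finset.sum_congr rfl fun b _ => Finset.sum_congr rfl fun l _ => ?_
    rw [neg_neg, hneg l j b, ← hcirc.apply_add b i l (a - b) 0, sub_add_cancel, zero_add]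
end
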